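/- arXiv:1503.00745 — 2 statements merged into one kernel-verified Lean document; each statement's English description precedes it below -/
import Mathlib

section
/- Run amalgamation: let ρ₀, ρ₁, ρ₂ be runs of a VAS A with ρ₀ ⊴ ρ₁ and ρ₀ ⊴ ρ₂. Then there exists a run ρ₃ such that ρ₁ ⊴ ρ₃ and ρ₂ ⊴ ρ₃. -/
/-- Configurations of a `d`-dimensional VAS: vectors in `ℕ^d`. -/
abbrev Conf (d : ℕ) := Fin d → ℕ

/-- Actions: vectors in `ℤ^d`. -/
abbrev Act (d : ℕ) := Fin d → ℤ

/-- Triples in `ℕ^d × ℤ^d × ℕ^d` (potential transitions). -/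
abbrev Trip (d : ℕ) := Conf d × Act d × Conf d

/-- Preruns: a source, a word of triples, and a target. -/
abbrev PreRun (d : ℕ) := Conf d × List (Trip d) × Conf d

/-- A transition of the VAS `A`: a triple `(u, a, v)` with `a ∈ A` and
`v = u + a`. -/
def IsTransition {d : ℕ} (A : Set (Act d)) (t : Trip d) : Prop :=
  t.2.1 ∈ A ∧ ∀ i, (t.2.2 i : ℤ) = (t.1 i : ℤ) + t.2.1 i

/-- `ChainFrom x w y` holds when the word `w` of triples chains from `x` to
`y`: either `w` is empty and `x = y`, or the first source is `x`, the last
target is `y`, and the target of each triple is the source of the next one. -/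
def ChainFrom {d : ℕ} : Conf d → List (Trip d) → Conf d → Prop
  | x, [], y => x = y
  | x, t :: w, y => t.1 = x ∧ ChainFrom t.2.2 w y

/-- A run of the VAS `A`: a prerun whose triples are transitions of `A`
chaining from its source to its target. -/
def IsRun {d : ℕ} (A : Set (Act d)) (ρ : PreRun d) : Prop :=
  (∀ t ∈ ρ.2.1, IsTransition A t) ∧ ChainFrom ρ.1 ρ.2.1 ρ.2.2

/-- Ordering on triples: same action, componentwise smaller source and
target. -/
def TripLE {d : ℕ} (t t' : Trip d) : Prop :=
  t.2.1 = t'.2.1 ∧ (∀ i, t.1 i ≤ t'.1 i) ∧ (∀ i, t.2.2 i ≤ t'.2.2 i)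

/-- Sequence embedding between lists, letters compared by `r`. -/
inductive SeqEmb {α : Type*} (r : α → α → Prop) : List α → List α → Prop
  | nil : ∀ l : List α, SeqEmb r [] l
  | cons : ∀ {x y : α} {l l' : List α}, r x y → SeqEmb r l l' →
      SeqEmb r (x :: l) (y :: l')
  | skip : ∀ {y : α} {l l' : List α}, SeqEmb r l l' → SeqEmb r l (y :: l')

/-- The ordering `⊴` on preruns: componentwise smaller source and target, and
embedding of the words of triples. -/
def PreRunLE {d : ℕ} (ρ ρ' : PreRun d) : Prop :=
  (∀ i, ρ.1 i ≤ ρ'.1 i) ∧ (∀ i, ρ.2.2 i ≤ ρ'.2.2 i) ∧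
    SeqEmb TripLE ρ.2.1 ρ'.2.1

/-- Membership in `PreRuns_A`: all actions along the word belong to `A`. -/
def IsPrerun {d : ℕ} (A : Set (Act d)) (ρ : PreRun d) : Prop :=
  ∀ t ∈ ρ.2.1, t.2.1 ∈ A

/-- The set of runs of `A` from `x` to `y`. -/
def Runs {d : ℕ} (A : Set (Act d)) (x y : Conf d) : Set (PreRun d) :=
  {ρ : PreRun d | IsRun A ρ ∧ ρ.1 = x ∧ ρ.2.2 = y}

/-- Downward closure inside `PreRuns_A` for `⊴`. -/
def DownIn {d : ℕ} (A : Set (Act d)) (Ω : Set (PreRun d)) : Set (PreRun d) :=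
  {ρ : PreRun d | IsPrerun A ρ ∧ ∃ ρ' ∈ Ω, PreRunLE ρ ρ'}

/-- Upward closure inside `PreRuns_A` for `⊴`. -/
def UpIn {d : ℕ} (A : Set (Act d)) (Ω : Set (PreRun d)) : Set (PreRun d) :=
  {ρ : PreRun d | IsPrerun A ρ ∧ ∃ ρ' ∈ Ω, PreRunLE ρ' ρ}

/-- `JoinRun A s w₁ w₂ y` holds when some run of `A` from `s` to `y` embeds both words `w₁` and
`w₂`. -/
def JoinRun {d : ℕ} (A : Set (Act d)) (s : Conf d) (w₁ w₂ : List (Trip d)) (y : Conf d) : Prop :=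
  ∃ w, IsRun A (s, w, y) ∧ SeqEmb TripLE w₁ w ∧ SeqEmb TripLE w₂ w

namespace JoinRun

variable {d : ℕ} {A : Set (Act d)} {s s' y : Conf d} {w₁ w₂ : List (Trip d)}

theorem symm (h : JoinRun A s w₁ w₂ y) : JoinRun A s w₂ w₁ y := by
  obtain ⟨w, h, e₁, e₂⟩ := h
  exact ⟨w, h, e₂, e₁⟩

theorem nil (s : Conf d) : JoinRun A s [] [] s :=
  ⟨[], ⟨by simp, rfl⟩, .nil _, .nil _⟩

/-- Prepending to a run a transition that is a translate of `t`. -/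
theorem isRun_cons_translate {t : Trip d} {w : List (Trip d)} (ht : IsTransition A t)
    (hs : ∀ i, s' i + t.1 i = s i + t.2.2 i) (h : IsRun A (s', w, y)) :
    IsRun A (s, (s, t.2.1, s') :: w, y) := by
  refine ⟨?_, rfl, h.2⟩
  intro r hr
  rcases List.mem_cons.1 hr with rfl | hr
  · refine ⟨ht.1, fun i => ?_⟩
    have h1 := ht.2 i
    have h2 := hs i
    dsimp only
    omega
  · exact h.1 r hr

theorem tripLE_translate {t : Trip d} (hle : ∀ i, t.1 i ≤ s i)
    (hs : ∀ i, s' i + t.1 i = s i + t.2.2 i) : TripLE t (s, t.2.1, s') := by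
  refine ⟨rfl, hle, fun i => ?_⟩
  have h1 := hs i
  have h2 := hle i
  dsimp only
  omega

theorem cons_left {t : Trip d} (ht : IsTransition A t) (hle : ∀ i, t.1 i ≤ s i)
    (hs : ∀ i, s' i + t.1 i = s i + t.2.2 i) (h : JoinRun A s' w₁ w₂ y) :
    JoinRun A s (t :: w₁) w₂ y := by
  obtain ⟨w, h, e₁, e₂⟩ := h
  exact ⟨_, isRun_cons_translate ht hs h, .cons (tripLE_translate hle hs) e₁, .skip e₂⟩

theorem cons_cons {t₁ t₂ : Trip d} (ht₁ : IsTransition A t₁) (hact : t₁.2.1 = t₂.2.1)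
    (hle₁ : ∀ i, t₁.1 i ≤ s i) (hle₂ : ∀ i, t₂.1 i ≤ s i)
    (hs₁ : ∀ i, s' i + t₁.1 i = s i + t₁.2.2 i) (hs₂ : ∀ i, s' i + t₂.1 i = s i + t₂.2.2 i)
    (h : JoinRun A s' w₁ w₂ y) : JoinRun A s (t₁ :: w₁) (t₂ :: w₂) y := by
  obtain ⟨w, h, e₁, e₂⟩ := h
  refine ⟨_, isRun_cons_translate ht₁ hs₁ h, .cons (tripLE_translate hle₁ hs₁) e₁, .cons ?_ e₂⟩
  rw [hact]
  exact tripLE_translate hle₂ hs₂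

end JoinRun

theorem IsRun.head {d : ℕ} {A : Set (Act d)} {x y : Conf d} {t : Trip d} {w : List (Trip d)}
    (h : IsRun A (x, t :: w, y)) : IsTransition A t ∧ t.1 = x ∧ IsRun A (t.2.2, w, y) :=
  ⟨h.1 t List.mem_cons_self, h.2.1, fun r hr => h.1 r (List.mem_cons_of_mem _ hr), h.2.2⟩

theorem joinRun_nil_left {d : ℕ} {A : Set (Act d)} {w : List (Trip d)} {s u q y : Conf d}
    (h : IsRun A (q, w, y)) (hq : ∀ i, q i ≤ s i) (hs : ∀ i, u i + q i = s i + y i) :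
    JoinRun A s [] w u := by
  induction w generalizing s q with
  | nil =>
    have hqy : q = y := h.2
    subst hqy
    have hsu : s = u := by
      funext i
      have := hs i
      omega
    subst hsu
    exact .nil s
  | cons t w ih =>
    obtain ⟨ht, rfl, h'⟩ := h.head
    have hs' : ∀ i, (s i + t.2.2 i - t.1 i) + t.1 i = s i + t.2.2 i := fun i => by
      have := hq i
      omega
    refine (JoinRun.cons_left (s' := fun i => s i + t.2.2 i - t.1 i) ht hq hs' ?_).symm
    refine (ih h' (fun i => ?_) (fun i => ?_)).symm <;>
      · have h1 := hq i
        have h2 := hs i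
        omega

theorem joinRun_of_le {d : ℕ} {A : Set (Act d)} {w₁ w₂ : List (Trip d)}
    {s u p q y₁ y₂ y : Conf d} (h₁ : IsRun A (p, w₁, y₁)) (h₂ : IsRun A (q, w₂, y₂))
    (hq : ∀ i, u i ≤ q i) (hy₁ : ∀ i, u i ≤ y₁ i)
    (hs : ∀ i, s i + u i = p i + q i) (hy : ∀ i, y i + u i = y₁ i + y₂ i) :
    JoinRun A s w₁ w₂ y := by
  induction w₁ generalizing s p with
  | nil =>
    have hpy : p = y₁ := h₁.2
    subst hpy
    refine joinRun_nil_left h₂ (fun i => ?_) (fun i => ?_) <;>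
      · have h1 := hy₁ i
        have h2 := hs i
        have h3 := hy i
        omega
  | cons t w₁ ih =>
    obtain ⟨ht, rfl, h₁'⟩ := h₁.head
    refine JoinRun.cons_left (s' := fun i => s i + t.2.2 i - t.1 i) ht
      (fun i => ?_) (fun i => ?_) (ih h₁' fun i => ?_) <;>
      · have h1 := hq i
        have h2 := hs i
        omega

/-- Two runs embedding a common run can be joined, even when the source of the first one is not
above the source `u` of the common run. -/
theorem joinRun_of_seqEmb {d : ℕ} {A : Set (Act d)} {w₀ w₁ w₂ : List (Trip d)}
    {s u p q y₀ y₁ y₂ y : Conf d} (e₁ : SeqEmb TripLE w₀ w₁) (e₂ : SeqEmb TripLE w₀ w₂)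
    (h₀ : IsRun A (u, w₀, y₀)) (h₁ : IsRun A (p, w₁, y₁)) (h₂ : IsRun A (q, w₂, y₂))
    (hq : ∀ i, u i ≤ q i) (hy₁ : ∀ i, y₀ i ≤ y₁ i)
    (hs : ∀ i, s i + u i = p i + q i) (hy : ∀ i, y i + y₀ i = y₁ i + y₂ i) :
    JoinRun A s w₁ w₂ y := by
  induction e₁ generalizing s u p q w₂ with
  | nil w₁ =>
    have huy : u = y₀ := h₀.2
    subst huy
    exact joinRun_of_le h₁ h₂ hq hy₁ hs hy
  | @skip t w₀ w₁ _ ih =>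
    obtain ⟨ht, rfl, h₁'⟩ := h₁.head
    refine JoinRun.cons_left (s' := fun i => s i + t.2.2 i - t.1 i) ht
      (fun i => ?_) (fun i => ?_) (ih e₂ h₀ h₁' h₂ hq fun i => ?_) <;>
      · have h1 := hq i
        have h2 := hs i
        omega
  | @cons t₀ t₁ w₀ w₁ le₁ _ ih =>
    obtain ⟨ht₀, rfl, h₀'⟩ := h₀.head
    obtain ⟨ht₁, rfl, h₁'⟩ := h₁.head
    clear hq
    generalize hw : t₀ :: w₀ = w at e₂
    induction e₂ generalizing s q with
    | nil => cases hw
    | @skip t _ w₂ _ ih₂ =>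
      obtain ⟨ht, rfl, h₂'⟩ := h₂.head
      refine (JoinRun.cons_left (s' := fun i => s i + t.2.2 i - t.1 i) ht
        (fun i => ?_) (fun i => ?_) (ih₂ h₂' (fun i => ?_) hw).symm).symm <;>
        · have h1 := le₁.2.1 i
          have h2 := hs i
          omega
    | @cons t t₂ _ w₂ le₂ e₂ _ =>
      cases hw
      obtain ⟨ht₂, rfl, h₂'⟩ := h₂.head
      have hact : t₁.2.1 = t₂.2.1 := le₁.1.symm.trans le₂.1
      refine JoinRun.cons_cons (s' := fun i => s i + t₁.2.2 i - t₁.1 i) ht₁ hact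
        (fun i => ?_) (fun i => ?_) (fun i => ?_) (fun i => ?_)
        (ih e₂ h₀' h₁' h₂' le₂.2.2 fun i => ?_) <;>
        · have h1 := le₁.2.1 i
          have h2 := le₂.2.1 i
          have h3 := hs i
          have h4 := ht₀.2 i
          have h5 := ht₁.2 i
          have h6 := ht₂.2 i
          have h7 := congrFun le₁.1 i
          have h8 := congrFun le₂.1 i
          omega

/-- Run amalgamation: if `ρ₀ ⊴ ρ₁` and `ρ₀ ⊴ ρ₂` for runs `ρ₀, ρ₁, ρ₂` of the
VAS `A`, then there is a run `ρ₃` with `ρ₁ ⊴ ρ₃` and `ρ₂ ⊴ ρ₃`. -/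
theorem run_amalgamation {d : ℕ} (A : Set (Act d)) (hA : A.Finite)
    (ρ₀ ρ₁ ρ₂ : PreRun d)
    (h₀ : IsRun A ρ₀) (h₁ : IsRun A ρ₁) (h₂ : IsRun A ρ₂)
    (h01 : PreRunLE ρ₀ ρ₁) (h02 : PreRunLE ρ₀ ρ₂) :
    ∃ ρ₃ : PreRun d, IsRun A ρ₃ ∧ PreRunLE ρ₁ ρ₃ ∧ PreRunLE ρ₂ ρ₃ := by
  obtain ⟨x₀, w₀, y₀⟩ := ρ₀
  obtain ⟨x₁, w₁, y₁⟩ := ρ₁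
  obtain ⟨x₂, w₂, y₂⟩ := ρ₂
  obtain ⟨hx₁, hy₁, e₁⟩ := h01
  obtain ⟨hx₂, hy₂, e₂⟩ := h02
  dsimp only at hx₁ hy₁ e₁ hx₂ hy₂ e₂
  have hs : ∀ i, (x₁ i + x₂ i - x₀ i) + x₀ i = x₁ i + x₂ i := fun i => by
    have := hx₁ i
    omega
  have hy : ∀ i, (y₁ i + y₂ i - y₀ i) + y₀ i = y₁ i + y₂ i := fun i => by
    have := hy₁ i
    omega
  obtain ⟨w, hw, f₁, f₂⟩ := joinRun_of_seqEmb (s := fun i => x₁ i + x₂ i - x₀ i)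
    (y := fun i => y₁ i + y₂ i - y₀ i) e₁ e₂ h₀ h₁ h₂ hx₂ hy₁ hs hy
  refine ⟨_, hw, ⟨fun i => ?_, fun i => ?_, f₁⟩, ⟨fun i => ?_, fun i => ?_, f₂⟩⟩ <;>
    · have h1 := hx₁ i
      have h2 := hx₂ i
      have h3 := hy₁ i
      have h4 := hy₂ i
      dsimp only
      omega
end

section
/- Let A be a VAS of dimension d and x, y ∈ ℕ^d. If ρ₀, ρ₁, ρ₂ ∈ Runs(x,y) satisfy ρ₀ ⊴ ρ₁ and ρ₀ ⊴ ρ₂, then there exists ρ₃ ∈ Runs(x,y) with ρ₁ ⊴ ρ₃ and ρ₂ ⊴ ρ₃. Consequently, for every run ρ ∈ Runs(x,y), the set ↓(↑ρ ∩ Runs(x,y)) (closures taken in PreRuns for ⊴) is an ideal of (PreRuns, ⊴). -/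
/-- An ideal of `(PreRuns_A, ⊴)`: a nonempty set of preruns, downward-closed
and directed for `⊴`. -/
def IsPrerunIdeal {d : ℕ} (A : Set (Act d)) (I : Set (PreRun d)) : Prop :=
  I ⊆ {ρ : PreRun d | IsPrerun A ρ} ∧ I.Nonempty ∧
    (∀ ρ ρ' : PreRun d, PreRunLE ρ ρ' → ρ' ∈ I → ρ ∈ I) ∧
    (∀ ρ₁ ∈ I, ∀ ρ₂ ∈ I, ∃ ρ ∈ I, PreRunLE ρ₁ ρ ∧ PreRunLE ρ₂ ρ)

namespace SeqEmb

variable {α : Type*} {r : α → α → Prop}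

theorem refl (hr : ∀ a, r a a) : ∀ l : List α, SeqEmb r l l
  | [] => .nil []
  | a :: l => .cons (hr a) (refl hr l)

theorem trans (hr : ∀ a b c, r a b → r b c → r a c) {l₁ l₂ l₃ : List α}
    (h₁ : SeqEmb r l₁ l₂) (h₂ : SeqEmb r l₂ l₃) : SeqEmb r l₁ l₃ := by
  induction h₂ generalizing l₁ with
  | nil l => cases h₁; exact .nil l
  | cons hab _ ih =>
    cases h₁ with
    | nil => exact .nil _
    | cons h h' => exact .cons (hr _ _ _ h hab) (ih h')
    | skip h' => exact .skip (ih h')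
  | skip _ ih => exact .skip (ih h₁)

theorem append_left {l l' : List α} (h : SeqEmb r l l') :
    ∀ p : List α, SeqEmb r l (p ++ l')
  | [] => h
  | _ :: p => .skip (append_left h p)

theorem append {l₁ l₁' l₂ l₂' : List α} (h₁ : SeqEmb r l₁ l₁')
    (h₂ : SeqEmb r l₂ l₂') : SeqEmb r (l₁ ++ l₂) (l₁' ++ l₂') := by
  induction h₁ with
  | nil l => exact h₂.append_left l
  | cons h _ ih => exact .cons h ih
  | skip _ ih => exact .skip ih

theorem map_of_forall {f : α → α} (hf : ∀ a, r a (f a)) :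
    ∀ l : List α, SeqEmb r l (l.map f)
  | [] => .nil []
  | a :: l => .cons (hf a) (map_of_forall hf l)

theorem exists_eq_append_cons {a : α} {l l' : List α} (h : SeqEmb r (a :: l) l') :
    ∃ p b s, l' = p ++ b :: s ∧ r a b ∧ SeqEmb r l s := by
  induction l' with
  | nil => cases h
  | cons c l' ih =>
    cases h with
    | cons h h' => exact ⟨[], c, l', rfl, h, h'⟩
    | skip h' =>
      obtain ⟨p, b, s, rfl, hb, hs⟩ := ih h'
      exact ⟨c :: p, b, s, rfl, hb, hs⟩

theorem exists_mem_of_mem {l l' : List α} (h : SeqEmb r l l') {a : α} (ha : a ∈ l) :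
    ∃ b ∈ l', r a b := by
  induction h with
  | nil l => simp at ha
  | cons hxy _ ih =>
    rcases List.mem_cons.1 ha with rfl | ha
    · exact ⟨_, List.mem_cons_self, hxy⟩
    · obtain ⟨b, hb, hab⟩ := ih ha
      exact ⟨b, List.mem_cons_of_mem _ hb, hab⟩
  | skip _ ih =>
    obtain ⟨b, hb, hab⟩ := ih ha
    exact ⟨b, List.mem_cons_of_mem _ hb, hab⟩

end SeqEmb

section VAS

variable {d : ℕ}

theorem TripLE.refl (t : Trip d) : TripLE t t :=
  ⟨rfl, fun _ => le_rfl, fun _ => le_rfl⟩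

theorem TripLE.trans (t₁ t₂ t₃ : Trip d) (h : TripLE t₁ t₂) (h' : TripLE t₂ t₃) :
    TripLE t₁ t₃ :=
  ⟨h.1.trans h'.1, fun i => (h.2.1 i).trans (h'.2.1 i), fun i => (h.2.2 i).trans (h'.2.2 i)⟩

theorem PreRunLE.refl (ρ : PreRun d) : PreRunLE ρ ρ :=
  ⟨fun _ => le_rfl, fun _ => le_rfl, SeqEmb.refl TripLE.refl _⟩

theorem PreRunLE.trans {ρ₁ ρ₂ ρ₃ : PreRun d} (h : PreRunLE ρ₁ ρ₂) (h' : PreRunLE ρ₂ ρ₃) :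
    PreRunLE ρ₁ ρ₃ :=
  ⟨fun i => (h.1 i).trans (h'.1 i), fun i => (h.2.1 i).trans (h'.2.1 i),
    h.2.2.trans TripLE.trans h'.2.2⟩

theorem IsPrerun.of_le {A : Set (Act d)} {ρ ρ' : PreRun d} (h : PreRunLE ρ ρ')
    (hρ' : IsPrerun A ρ') : IsPrerun A ρ := by
  intro t ht
  obtain ⟨t', ht', hle⟩ := h.2.2.exists_mem_of_mem ht
  exact hle.1 ▸ hρ' t' ht'

theorem IsRun.isPrerun {A : Set (Act d)} {ρ : PreRun d} (h : IsRun A ρ) : IsPrerun A ρ :=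
  fun t ht => (h.1 t ht).1

theorem isRun_nil {A : Set (Act d)} {x y : Conf d} : IsRun A (x, [], y) ↔ x = y := by
  simp [IsRun, ChainFrom]

theorem isRun_cons {A : Set (Act d)} {x y : Conf d} {t : Trip d} {w : List (Trip d)} :
    IsRun A (x, t :: w, y) ↔ IsTransition A t ∧ t.1 = x ∧ IsRun A (t.2.2, w, y) := by
  simp only [IsRun, ChainFrom, List.forall_mem_cons]
  tauto

theorem isRun_append {A : Set (Act d)} {x y : Conf d} {w w' : List (Trip d)} :
    IsRun A (x, w ++ w', y) ↔ ∃ z, IsRun A (x, w, z) ∧ IsRun A (z, w', y) := by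
  induction w generalizing x with
  | nil => simp [isRun_nil]
  | cons t w ih =>
    simp only [List.cons_append, isRun_cons, ih]
    tauto

/-- Translate both endpoints of a triple by a configuration. -/
def Trip.shift (c : Conf d) (t : Trip d) : Trip d := (t.1 + c, t.2.1, t.2.2 + c)

theorem Trip.le_shift (c : Conf d) (t : Trip d) : TripLE t (t.shift c) :=
  ⟨rfl, fun _ => Nat.le_add_right _ _, fun _ => Nat.le_add_right _ _⟩

theorem IsTransition.shift {A : Set (Act d)} {t : Trip d} (h : IsTransition A t) (c : Conf d) :
    IsTransition A (t.shift c) := by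
  refine ⟨h.1, fun i => ?_⟩
  have := h.2 i
  simp only [Trip.shift, Pi.add_apply]
  push_cast
  linarith

theorem IsRun.shift {A : Set (Act d)} {x y : Conf d} {w : List (Trip d)}
    (h : IsRun A (x, w, y)) (c : Conf d) :
    IsRun A (x + c, w.map (Trip.shift c), y + c) := by
  induction w generalizing x with
  | nil => simpa [isRun_nil] using h
  | cons t w ih =>
    obtain ⟨ht, rfl, hw⟩ := isRun_cons.1 h
    exact isRun_cons.2 ⟨ht.shift c, rfl, ih hw⟩

/-- Two runs played one after the other, each translated by the excess over `p₀` that the other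
one has reached. -/
theorem IsRun.shift_append_shift {A : Set (Act d)} {p₀ p₁ p₂ q₁ q₂ : Conf d}
    {w₁ w₂ : List (Trip d)} (h₁ : IsRun A (p₁, w₁, q₁)) (h₂ : IsRun A (p₂, w₂, q₂))
    (hp₂ : p₀ ≤ p₂) (hq₁ : p₀ ≤ q₁) :
    IsRun A (p₁ + (p₂ - p₀),
      w₁.map (Trip.shift (p₂ - p₀)) ++ w₂.map (Trip.shift (q₁ - p₀)), q₁ + q₂ - p₀) := by
  refine isRun_append.2 ⟨_, h₁.shift _, ?_⟩
  have h := h₂.shift (q₁ - p₀)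
  have e : p₂ + (q₁ - p₀) = q₁ + (p₂ - p₀) := by
    rw [← add_tsub_assoc_of_le hq₁, ← add_tsub_assoc_of_le hp₂, add_comm]
  rwa [e, ← add_tsub_assoc_of_le hq₁, add_comm q₂] at h

theorem exists_isRun_amalgam {A : Set (Act d)} {p₀ p₁ p₂ q₀ q₁ q₂ : Conf d}
    {w₀ w₁ w₂ : List (Trip d)} (h₀ : IsRun A (p₀, w₀, q₀)) (h₁ : IsRun A (p₁, w₁, q₁))
    (h₂ : IsRun A (p₂, w₂, q₂)) (h₀₁ : PreRunLE (p₀, w₀, q₀) (p₁, w₁, q₁))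
    (h₀₂ : PreRunLE (p₀, w₀, q₀) (p₂, w₂, q₂)) :
    ∃ w₃, IsRun A (p₁ + p₂ - p₀, w₃, q₁ + q₂ - q₀) ∧
      SeqEmb TripLE w₁ w₃ ∧ SeqEmb TripLE w₂ w₃ := by
  induction w₀ generalizing p₀ p₁ p₂ w₁ w₂ with
  | nil =>
    obtain rfl := isRun_nil.1 h₀
    refine ⟨w₁.map (Trip.shift (p₂ - p₀)) ++ w₂.map (Trip.shift (q₁ - p₀)), ?_, ?_, ?_⟩
    · have := h₁.shift_append_shift h₂ h₀₂.1 h₀₁.2.1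
      rwa [← add_tsub_assoc_of_le (show p₀ ≤ p₂ from h₀₂.1)] at this
    · simpa using (SeqEmb.map_of_forall (Trip.le_shift (p₂ - p₀)) w₁).append
        (.nil (w₂.map (Trip.shift (q₁ - p₀))))
    · exact (SeqEmb.map_of_forall (Trip.le_shift _) w₂).append_left _
  | cons t₀ w₀ ih =>
    obtain ⟨ht₀, rfl, hw₀⟩ := isRun_cons.1 h₀
    obtain ⟨hp₁, hq₁, e₁⟩ := h₀₁
    obtain ⟨hp₂, hq₂, e₂⟩ := h₀₂
    obtain ⟨u₁, t₁, v₁, rfl, l₁, s₁⟩ := e₁.exists_eq_append_cons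
    obtain ⟨u₂, t₂, v₂, rfl, l₂, s₂⟩ := e₂.exists_eq_append_cons
    obtain ⟨_, hu₁, htv₁⟩ := isRun_append.1 h₁
    obtain ⟨_, hu₂, htv₂⟩ := isRun_append.1 h₂
    obtain ⟨ht₁, rfl, hv₁⟩ := isRun_cons.1 htv₁
    obtain ⟨ht₂, rfl, hv₂⟩ := isRun_cons.1 htv₂
    obtain ⟨w, hw, f₁, f₂⟩ :=
      ih hw₀ hv₁ hv₂ ⟨l₁.2.2, hq₁, s₁⟩ ⟨l₂.2.2, hq₂, s₂⟩
    have hu := hu₁.shift_append_shift hu₂ hp₂ l₁.2.1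
    rw [← add_tsub_assoc_of_le (show t₀.1 ≤ p₂ from hp₂)] at hu
    set t : Trip d := (t₁.1 + t₂.1 - t₀.1, t₀.2.1, t₁.2.2 + t₂.2.2 - t₀.2.2)
    have ht : IsTransition A t := by
      refine ⟨ht₀.1, fun i => ?_⟩
      have a₀ := ht₀.2 i
      have a₁ := ht₁.2 i
      have a₂ := ht₂.2 i
      rw [← l₁.1] at a₁
      rw [← l₂.1] at a₂
      have := l₁.2.1 i
      have := l₁.2.2 i
      simp only [t, Pi.add_apply, Pi.sub_apply]
      omega
    have hle₁ : TripLE t₁ t := by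
      refine ⟨l₁.1.symm, fun i => ?_, fun i => ?_⟩
      · have := l₂.2.1 i
        simp only [t, Pi.add_apply, Pi.sub_apply]
        omega
      · have := l₂.2.2 i
        simp only [t, Pi.add_apply, Pi.sub_apply]
        omega
    have hle₂ : TripLE t₂ t := by
      refine ⟨l₂.1.symm, fun i => ?_, fun i => ?_⟩
      · have := l₁.2.1 i
        simp only [t, Pi.add_apply, Pi.sub_apply]
        omega
      · have := l₁.2.2 i
        simp only [t, Pi.add_apply, Pi.sub_apply]
        omega
    refine ⟨_, isRun_append.2 ⟨_, hu, isRun_cons.2 ⟨ht, rfl, hw⟩⟩, ?_, ?_⟩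
    · rw [List.append_assoc]
      exact (SeqEmb.map_of_forall (Trip.le_shift _) u₁).append
        ((SeqEmb.cons hle₁ f₁).append_left _)
    · exact ((SeqEmb.map_of_forall (Trip.le_shift _) u₂).append_left _).append
        (SeqEmb.cons hle₂ f₂)

theorem exists_mem_runs_amalgam {A : Set (Act d)} {x y : Conf d} {ρ₀ ρ₁ ρ₂ : PreRun d}
    (h₀ : ρ₀ ∈ Runs A x y) (h₁ : ρ₁ ∈ Runs A x y) (h₂ : ρ₂ ∈ Runs A x y)
    (h₀₁ : PreRunLE ρ₀ ρ₁) (h₀₂ : PreRunLE ρ₀ ρ₂) :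
    ∃ ρ₃ ∈ Runs A x y, PreRunLE ρ₁ ρ₃ ∧ PreRunLE ρ₂ ρ₃ := by
  obtain ⟨_, w₀, _⟩ := ρ₀
  obtain ⟨_, w₁, _⟩ := ρ₁
  obtain ⟨_, w₂, _⟩ := ρ₂
  obtain ⟨h₀, rfl, rfl⟩ := h₀
  obtain ⟨h₁, rfl, rfl⟩ := h₁
  obtain ⟨h₂, rfl, rfl⟩ := h₂
  obtain ⟨w₃, h₃, e₁, e₂⟩ := exists_isRun_amalgam h₀ h₁ h₂ h₀₁ h₀₂
  simp only [add_tsub_cancel_right] at h₃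
  exact ⟨_, ⟨h₃, rfl, rfl⟩, ⟨fun _ => le_rfl, fun _ => le_rfl, e₁⟩,
    ⟨fun _ => le_rfl, fun _ => le_rfl, e₂⟩⟩

end VAS

/-- Amalgamation within `Runs(x,y)`: if `ρ₀ ⊴ ρ₁` and `ρ₀ ⊴ ρ₂` for
`ρ₀, ρ₁, ρ₂ ∈ Runs(x,y)`, then some `ρ₃ ∈ Runs(x,y)` satisfies `ρ₁ ⊴ ρ₃` and
`ρ₂ ⊴ ρ₃`.  Consequently, for every `ρ ∈ Runs(x,y)`, the set
`↓(↑ρ ∩ Runs(x,y))` (closures taken inside `PreRuns_A` for `⊴`) is an ideal of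
`(PreRuns_A, ⊴)`. -/
theorem runs_amalgamation_and_ideal {d : ℕ} (A : Set (Act d)) (hA : A.Finite)
    (x y : Conf d) :
    (∀ ρ₀ ∈ Runs A x y, ∀ ρ₁ ∈ Runs A x y, ∀ ρ₂ ∈ Runs A x y,
      PreRunLE ρ₀ ρ₁ → PreRunLE ρ₀ ρ₂ →
        ∃ ρ₃ ∈ Runs A x y, PreRunLE ρ₁ ρ₃ ∧ PreRunLE ρ₂ ρ₃) ∧
    (∀ ρ ∈ Runs A x y,
      IsPrerunIdeal A (DownIn A (UpIn A {ρ} ∩ Runs A x y))) := by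
  refine ⟨fun ρ₀ h₀ ρ₁ h₁ ρ₂ h₂ h₀₁ h₀₂ => exists_mem_runs_amalgam h₀ h₁ h₂ h₀₁ h₀₂,
    fun ρ hρ => ⟨fun σ hσ => hσ.1, ?_, ?_, ?_⟩⟩
  · exact ⟨ρ, hρ.1.isPrerun, ρ, ⟨⟨hρ.1.isPrerun, ρ, rfl, .refl ρ⟩, hρ⟩, .refl ρ⟩
  · rintro σ σ' hle ⟨hσ', τ, hτ, hle'⟩
    exact ⟨hσ'.of_le hle, τ, hτ, hle.trans hle'⟩
  · rintro σ₁ ⟨-, ρ₁, ⟨⟨-, _, rfl, h₀₁⟩, h₁⟩, hσ₁⟩ σ₂ ⟨-, ρ₂, ⟨⟨-, _, rfl, h₀₂⟩, h₂⟩, hσ₂⟩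
    obtain ⟨ρ₃, h₃, h₁₃, h₂₃⟩ := exists_mem_runs_amalgam hρ h₁ h₂ h₀₁ h₀₂
    exact ⟨ρ₃, ⟨h₃.1.isPrerun, ρ₃, ⟨⟨h₃.1.isPrerun, _, rfl, h₀₁.trans h₁₃⟩, h₃⟩, .refl ρ₃⟩,
      hσ₁.trans h₁₃, hσ₂.trans h₂₃⟩
end
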